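/- Let D ⊆ ℝⁿ be open, let ℓ be a local action on D, let b : D → ℝⁿ be a drift of ℓ, and let x ∈ D with b(x) ≠ 0. Let φ : [0,1] → D be continuous with φ(1/2) = x, suppose that for every a ∈ (0,1/2) the restrictions of φ to [0, 1/2 − a] and to [1/2 + a, 1] are absolutely continuous, and suppose that the length of φ away from 1/2 diverges: lim_{a→0⁺} ∫_{[0,1/2−a] ∪ [1/2+a,1]} |φ′(α)| dα = ∞. Then the action also diverges: lim_{a→0⁺} ∫_{[0,1/2−a] ∪ [1/2+a,1]} ℓ(φ(α), φ′(α)) dα = ∞. (In other words, a curve of finite action can pass a point in infinite length only if every drift vanishes there.) -/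

import Mathlib

open MeasureTheory Set Filter
open scoped RealInnerProductSpace

abbrev Euc (n : ℕ) := EuclideanSpace ℝ (Fin n)

/-- A local action is bounded by a multiple of the norm over every compact set. -/
theorem exists_le_mul_norm_of_homogeneous {n : ℕ} {D K : Set (Euc n)} {ℓ : Euc n → Euc n → ℝ}
    (hℓcont : ContinuousOn (fun p : Euc n × Euc n => ℓ p.1 p.2) (D ×ˢ Set.univ))
    (hℓhom : ∀ x ∈ D, ∀ y : Euc n, ∀ c : ℝ, 0 ≤ c → ℓ x (c • y) = c * ℓ x y)
    (hKD : K ⊆ D) (hK : IsCompact K) :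
    ∃ C : ℝ, ∀ x ∈ K, ∀ y : Euc n, ℓ x y ≤ C * ‖y‖ := by
  obtain ⟨C, hC⟩ := ((hK.prod (isCompact_closedBall (0 : Euc n) 1)).bddAbove_image
    (hℓcont.mono (Set.prod_mono hKD (Set.subset_univ _))))
  refine ⟨C, fun x hx y => ?_⟩
  have hle : ℓ x (‖y‖⁻¹ • y) ≤ C := by
    refine hC ⟨(x, ‖y‖⁻¹ • y), ⟨hx, ?_⟩, rfl⟩
    rw [mem_closedBall_zero_iff, norm_smul, norm_inv, norm_norm]
    exact inv_mul_le_one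
  have hy : y = ‖y‖ • (‖y‖⁻¹ • y) := by
    by_cases h : y = 0
    · simp [h]
    · rw [smul_smul, mul_inv_cancel₀ (norm_ne_zero_iff.mpr h), one_smul]
  calc ℓ x y = ℓ x (‖y‖ • (‖y‖⁻¹ • y)) := by rw [← hy]
    _ = ‖y‖ * ℓ x (‖y‖⁻¹ • y) := hℓhom x (hKD hx) _ _ (norm_nonneg y)
    _ ≤ C * ‖y‖ := by
      rw [mul_comm]
      exact mul_le_mul_of_nonneg_right hle (norm_nonneg y)

/-- The action density of a curve is integrable wherever its velocity is. -/
theorem integrableOn_action {n : ℕ} {D : Set (Euc n)} (hD : IsOpen D) {ℓ : Euc n → Euc n → ℝ}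
    (hℓcont : ContinuousOn (fun p : Euc n × Euc n => ℓ p.1 p.2) (D ×ˢ Set.univ))
    (hℓnonneg : ∀ x ∈ D, ∀ y : Euc n, 0 ≤ ℓ x y)
    {C : ℝ} {φ φ' : ℝ → Euc n} {S : Set ℝ} (hS : MeasurableSet S)
    (hφ : ContinuousOn φ S) (hφD : ∀ t ∈ S, φ t ∈ D)
    (hC : ∀ t ∈ S, ∀ y : Euc n, ℓ (φ t) y ≤ C * ‖y‖) (hφ' : IntegrableOn φ' S) :
    IntegrableOn (fun t => ℓ (φ t) (φ' t)) S := by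
  classical
  have hG : Measurable ((D ×ˢ (Set.univ : Set (Euc n))).piecewise
      (fun p : Euc n × Euc n => ℓ p.1 p.2) (fun _ => 0)) :=
    hℓcont.measurable_piecewise continuousOn_const (hD.prod isOpen_univ).measurableSet
  have hm : AEMeasurable (fun t => ℓ (φ t) (φ' t)) (volume.restrict S) := by
    refine (hG.comp_aemeasurable
      ((hφ.aemeasurable hS).prodMk hφ'.aestronglyMeasurable.aemeasurable)).congr ?_
    filter_upwards [ae_restrict_mem hS] with t ht
    exact Set.piecewise_eq_of_mem _ _ _ ⟨hφD t ht, Set.mem_univ _⟩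
  refine Integrable.mono' (hφ'.norm.const_mul C) hm.aestronglyMeasurable ?_
  filter_upwards [ae_restrict_mem hS] with t ht
  rw [Real.norm_of_nonneg (hℓnonneg _ (hφD t ht) _)]
  exact hC t ht _

/-- Near a vector `u`, the drift inequality yields a lower bound that is uniform up to a term
linear in the velocity. -/
theorem half_norm_mul_norm_sub_inner_le {E : Type*} [NormedAddCommGroup E]
    [InnerProductSpace ℝ E] {u v : E} (h : ‖v - u‖ ≤ ‖u‖ / 4) (y : E) :
    ‖u‖ / 2 * ‖y‖ - ⟪u, y⟫ ≤ ‖v‖ * ‖y‖ - ⟪v, y⟫ := by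
  have h₁ : ⟪v, y⟫ - ⟪u, y⟫ ≤ ‖u‖ / 4 * ‖y‖ := by
    rw [← inner_sub_left]
    exact (real_inner_le_norm _ _).trans (mul_le_mul_of_nonneg_right h (norm_nonneg y))
  have h₂ : ‖u‖ - ‖u‖ / 4 ≤ ‖v‖ := by
    have := norm_sub_norm_le u v
    rw [norm_sub_rev] at this
    linarith
  nlinarith [mul_le_mul_of_nonneg_right h₂ (norm_nonneg y)]

/-- a curve that passes a point with nonzero drift in infinite
length must have infinite action: if the lengths of the curve away from the
midpoint diverge, so do the actions. -/
theorem statement16 {n : ℕ} (D : Set (Euc n)) (hD : IsOpen D) (hDne : D.Nonempty)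
    (ℓ : Euc n → Euc n → ℝ)
    (hℓcont : ContinuousOn (fun p : Euc n × Euc n => ℓ p.1 p.2) (D ×ˢ Set.univ))
    (hℓnonneg : ∀ x ∈ D, ∀ y : Euc n, 0 ≤ ℓ x y)
    (hℓhom : ∀ x ∈ D, ∀ y : Euc n, ∀ c : ℝ, 0 ≤ c → ℓ x (c • y) = c * ℓ x y)
    (hℓconv : ∀ x ∈ D, ConvexOn ℝ Set.univ (fun y => ℓ x y))
    (b : Euc n → Euc n) (hb : ContDiffOn ℝ 1 b D)
    (hdrift : ∀ K ⊆ D, IsCompact K → ∃ A > (0:ℝ), ∀ x ∈ K, ∀ y : Euc n,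
      A * (‖b x‖ * ‖y‖ - ⟪b x, y⟫) ≤ ℓ x y)
    (x : Euc n) (hx : x ∈ D) (hbx : b x ≠ 0)
    (φ φ' : ℝ → Euc n)
    (hφcont : ContinuousOn φ (Set.Icc 0 1))
    (hφD : ∀ t ∈ Set.Icc (0:ℝ) 1, φ t ∈ D)
    (hφhalf : φ (1/2) = x)
    (hACleft : ∀ a ∈ Set.Ioo (0:ℝ) (1/2),
      MeasureTheory.IntegrableOn φ' (Set.Icc 0 (1/2 - a)) ∧
        ∀ t ∈ Set.Icc (0:ℝ) (1/2 - a), φ t = φ 0 + ∫ s in (0:ℝ)..t, φ' s)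
    (hACright : ∀ a ∈ Set.Ioo (0:ℝ) (1/2),
      MeasureTheory.IntegrableOn φ' (Set.Icc (1/2 + a) 1) ∧
        ∀ t ∈ Set.Icc (1/2 + a) (1:ℝ), φ t = φ (1/2 + a) + ∫ s in (1/2 + a)..t, φ' s)
    (hlen : Tendsto
      (fun a : ℝ => ∫ α in Set.Icc 0 (1/2 - a) ∪ Set.Icc (1/2 + a) 1, ‖φ' α‖)
      (nhdsWithin 0 (Set.Ioi 0)) atTop) :
    Tendsto
      (fun a : ℝ => ∫ α in Set.Icc 0 (1/2 - a) ∪ Set.Icc (1/2 + a) 1, ℓ (φ α) (φ' α))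
      (nhdsWithin 0 (Set.Ioi 0)) atTop := by
  set S : ℝ → Set ℝ := fun a => Icc 0 (1/2 - a) ∪ Icc (1/2 + a) 1
  have hSm : ∀ a, MeasurableSet (S a) := fun a => measurableSet_Icc.union measurableSet_Icc
  have hSI : ∀ a ∈ Ioo (0:ℝ) (1/2), S a ⊆ Icc 0 1 := by
    rintro a ⟨ha, ha'⟩ t (ht | ht)
    · exact ⟨ht.1, by linarith [ht.2]⟩
    · exact ⟨by linarith [ht.1], ht.2⟩
  have hKD : φ '' Icc 0 1 ⊆ D := Set.image_subset_iff.mpr hφD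
  have hK : IsCompact (φ '' Icc 0 1) := isCompact_Icc.image_of_continuousOn hφcont
  obtain ⟨A, hA, hdr⟩ := hdrift _ hKD hK
  obtain ⟨C, hC⟩ := exists_le_mul_norm_of_homogeneous hℓcont hℓhom hKD hK
  obtain ⟨M, hM⟩ := hK.isBounded.exists_norm_le
  have hφ'S : ∀ a ∈ Ioo (0:ℝ) (1/2), IntegrableOn φ' (S a) := fun a ha =>
    (hACleft a ha).1.union (hACright a ha).1
  have hℓS : ∀ a ∈ Ioo (0:ℝ) (1/2), IntegrableOn (fun t => ℓ (φ t) (φ' t)) (S a) :=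
    fun a ha => integrableOn_action hD hℓcont hℓnonneg (hSm a) (hφcont.mono (hSI a ha))
      (fun t ht => hφD t (hSI a ha ht)) (fun t ht => hC _ ⟨t, hSI a ha ht, rfl⟩) (hφ'S a ha)
  -- the velocity has bounded integral, since the curve itself is bounded
  have hφ'M : ∀ a ∈ Ioo (0:ℝ) (1/2), ‖∫ t in S a, φ' t‖ ≤ 4 * M := by
    intro a ha
    have hdisj : Disjoint (Icc (0:ℝ) (1/2 - a)) (Icc (1/2 + a) 1) := by
      rw [Set.disjoint_left]
      intro t h₁ h₂
      linarith [h₁.2, h₂.1, ha.1]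
    have hl := (hACleft a ha).2 (1/2 - a) ⟨by linarith [ha.2], le_rfl⟩
    have hr := (hACright a ha).2 1 ⟨by linarith [ha.2], le_rfl⟩
    rw [setIntegral_union hdisj measurableSet_Icc (hACleft a ha).1 (hACright a ha).1,
      integral_Icc_eq_integral_Ioc, integral_Icc_eq_integral_Ioc,
      ← intervalIntegral.integral_of_le (by linarith [ha.2]),
      ← intervalIntegral.integral_of_le (by linarith [ha.2]),
      ← sub_eq_iff_eq_add'.mpr hl, ← sub_eq_iff_eq_add'.mpr hr]
    have hn : ∀ t ∈ Icc (0:ℝ) 1, ‖φ t‖ ≤ M := fun t ht => hM _ ⟨t, ht, rfl⟩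
    have h₀ := hn 0 ⟨le_rfl, zero_le_one⟩
    have h₁ := hn 1 ⟨zero_le_one, le_rfl⟩
    have h₂ := hn (1/2 - a) ⟨by linarith [ha.2], by linarith [ha.1]⟩
    have h₃ := hn (1/2 + a) ⟨by linarith [ha.1], by linarith [ha.2]⟩
    linarith [norm_add_le (φ (1/2 - a) - φ 0) (φ 1 - φ (1/2 + a)),
      norm_sub_le (φ (1/2 - a)) (φ 0), norm_sub_le (φ 1) (φ (1/2 + a))]
  have hbpos : 0 < ‖b x‖ := norm_pos_iff.mpr hbx
  obtain ⟨δ, hδ, hbδ⟩ : ∃ δ ∈ Ioo (0:ℝ) (1/2), ∀ t ∈ Icc (0:ℝ) 1, dist t (1/2) < δ →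
      ‖b (φ t) - b x‖ ≤ ‖b x‖ / 4 := by
    have hcont : ContinuousOn (fun t => b (φ t)) (Icc 0 1) := hb.continuousOn.comp hφcont hφD
    obtain ⟨ε, hε, h⟩ := Metric.continuousOn_iff.mp hcont (1/2) ⟨by norm_num, by norm_num⟩
      (‖b x‖ / 4) (by positivity)
    refine ⟨min ε (1/4), ⟨by positivity, (min_le_right _ _).trans_lt (by norm_num)⟩, ?_⟩
    intro t ht hdist
    have := h t ht (hdist.trans_le (min_le_left _ _))
    rw [hφhalf, dist_eq_norm] at this
    exact this.le
  set c : ℝ := A * (‖b x‖ / 2) with hc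
  have hcpos : 0 < c := by positivity
  set g : ℝ → ℝ := fun t => ℓ (φ t) (φ' t) - (c * ‖φ' t‖ - A * ⟪b x, φ' t⟫) with hg
  have hcI : ∀ a ∈ Ioo (0:ℝ) (1/2), IntegrableOn (fun t => c * ‖φ' t‖) (S a) :=
    fun a ha => (hφ'S a ha).norm.const_mul c
  have hAI : ∀ a ∈ Ioo (0:ℝ) (1/2), IntegrableOn (fun t => A * ⟪b x, φ' t⟫) (S a) :=
    fun a ha => Integrable.const_mul ((hφ'S a ha).const_inner (b x)) A
  have hgI : ∀ a ∈ Ioo (0:ℝ) (1/2), IntegrableOn g (S a) :=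
    fun a ha => (hℓS a ha).sub ((hcI a ha).sub (hAI a ha))
  have hglow : ∀ a ∈ Ioo (0:ℝ) δ, ∫ t in S δ, g t ≤ ∫ t in S a, g t := by
    intro a ha
    have ha' : a ∈ Ioo (0:ℝ) (1/2) := ⟨ha.1, ha.2.trans hδ.2⟩
    have hsub : S δ ⊆ S a := Set.union_subset_union
      (Icc_subset_Icc_right (by linarith [ha.2])) (Icc_subset_Icc_left (by linarith [ha.2]))
    rw [← sub_nonneg, ← setIntegral_sdiff (hSm δ) (hgI a ha') hsub]
    refine setIntegral_nonneg ((hSm a).diff (hSm δ)) fun t ht => ?_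
    have htI := hSI a ha' ht.1
    have hdist : dist t (1/2) < δ := by
      by_contra! hge
      refine ht.2 ?_
      rw [Real.dist_eq] at hge
      rcases le_abs.mp hge with h | h
      · exact Or.inr ⟨by linarith, htI.2⟩
      · exact Or.inl ⟨htI.1, by linarith⟩
    have h₁ := hdr _ ⟨t, htI, rfl⟩ (φ' t)
    have h₂ := mul_le_mul_of_nonneg_left
      (half_norm_mul_norm_sub_inner_le (hbδ t htI hdist) (φ' t)) hA.le
    simp only [hg, hc]
    linarith
  have hbound : ∀ a ∈ Ioo (0:ℝ) δ,
      c * (∫ t in S a, ‖φ' t‖) + ((∫ t in S δ, g t) - A * (‖b x‖ * (4 * M))) ≤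
        ∫ t in S a, ℓ (φ t) (φ' t) := by
    intro a ha
    have ha' : a ∈ Ioo (0:ℝ) (1/2) := ⟨ha.1, ha.2.trans hδ.2⟩
    have h₁ : ∫ t in S a, g t = (∫ t in S a, ℓ (φ t) (φ' t)) -
        (c * (∫ t in S a, ‖φ' t‖) - A * ⟪b x, ∫ t in S a, φ' t⟫) := by
      have hI : IntegrableOn (fun t => c * ‖φ' t‖ - A * ⟪b x, φ' t⟫) (S a) :=
        (hcI a ha').sub (hAI a ha')
      rw [integral_sub (hℓS a ha') hI,
        integral_sub (hcI a ha') (hAI a ha'), integral_const_mul, integral_const_mul,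
        integral_inner (hφ'S a ha')]
    have h₂ : ⟪b x, ∫ t in S a, φ' t⟫ ≤ ‖b x‖ * (4 * M) :=
      (real_inner_le_norm _ _).trans
        (mul_le_mul_of_nonneg_left (hφ'M a ha') (norm_nonneg _))
    linarith [hglow a ha, mul_le_mul_of_nonneg_left h₂ hA.le]
  exact tendsto_atTop_mono' _ (by filter_upwards [Ioo_mem_nhdsGT hδ.1] with a ha using hbound a ha)
    (tendsto_atTop_add_const_right _ ((∫ t in S δ, g t) - A * (‖b x‖ * (4 * M)))
      (hlen.const_mul_atTop hcpos))
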